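/- A finite simple graph G is perfect if and only if its complement graph is perfect. (Weak Perfect Graph Theorem) -/

import Mathlib

open SimpleGraph

/-- A finite simple graph is perfect if every induced subgraph has
chromatic number equal to clique number. -/
def SimpleGraph.IsPerfect {V : Type*} [Fintype V] (G : SimpleGraph V) : Prop :=
  ∀ s : Set V, (G.induce s).chromaticNumber = ((G.induce s).cliqueNum : ℕ∞)

namespace SimpleGraph

open Finset

variable {V : Type*}

/-- The vertices in `S` can be properly coloured with the colours `0, …, k - 1`. -/
def ColorableOn (G : SimpleGraph V) (S : Finset V) (k : ℕ) : Prop :=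
  ∃ f : V → ℕ, (∀ v ∈ S, f v < k) ∧ ∀ v ∈ S, ∀ w ∈ S, G.Adj v w → f v ≠ f w

theorem ColorableOn.mono {G : SimpleGraph V} {S : Finset V} {k l : ℕ} (h : G.ColorableOn S k)
    (hkl : k ≤ l) : G.ColorableOn S l := by
  obtain ⟨f, hf, hf'⟩ := h
  exact ⟨f, fun v hv => (hf v hv).trans_le hkl, hf'⟩

theorem colorableOn_iff_colorable_induce {G : SimpleGraph V} {S : Finset V} {k : ℕ} :
    G.ColorableOn S k ↔ (G.induce (S : Set V)).Colorable k := by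
  classical
  constructor
  · rintro ⟨f, hf, hf'⟩
    exact ⟨Coloring.mk (fun v => ⟨f v, hf v v.2⟩) fun {v w} h he =>
      hf' v v.2 w w.2 h (congrArg Fin.val he)⟩
  · rintro ⟨C⟩
    refine ⟨fun v => if h : v ∈ S then C ⟨v, h⟩ else 0, fun v hv => ?_, fun v hv w hw h => ?_⟩
    · simp [hv]
    · have := C.valid (v := ⟨v, hv⟩) (w := ⟨w, hw⟩) h
      simpa [hv, hw, Fin.ext_iff] using this

theorem isPerfect_iff_forall_colorableOn [Fintype V] {G : SimpleGraph V} :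
    G.IsPerfect ↔ ∀ S : Finset V, ∃ K ⊆ S, G.IsClique (K : Set V) ∧ G.ColorableOn S #K := by
  classical
  constructor
  · intro h S
    obtain ⟨K, hK⟩ := (G.induce (S : Set V)).exists_isNClique_cliqueNum
    refine ⟨K.map (Function.Embedding.subtype _), fun v hv => ?_, ?_, ?_⟩
    · simp only [mem_map] at hv
      obtain ⟨w, -, rfl⟩ := hv
      exact w.2
    · intro v hv w hw hvw
      simp only [coe_map, Set.mem_image] at hv hw
      obtain ⟨v, hv, rfl⟩ := hv
      obtain ⟨w, hw, rfl⟩ := hw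
      exact hK.isClique hv hw fun e => hvw (by rw [e])
    · rw [card_map, hK.card_eq, colorableOn_iff_colorable_induce,
        ← chromaticNumber_le_iff_colorable]
      exact (h S).le
  · intro h s
    refine le_antisymm ?_ cliqueNum_le_chromaticNumber
    obtain ⟨K, hKs, hK, hc⟩ := h s.toFinset
    rw [colorableOn_iff_colorable_induce, Set.coe_toFinset] at hc
    refine hc.chromaticNumber_le.trans (Nat.cast_le.2 ?_)
    have hK' : (G.induce s).IsClique (K.subtype (· ∈ s) : Set s) := by
      intro v hv w hw hvw
      simp only [mem_coe, mem_subtype] at hv hw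
      exact hK hv hw fun e => hvw (Subtype.ext e)
    have := hK'.card_le_cliqueNum
    rwa [card_subtype, filter_true_of_mem fun v hv => Set.mem_toFinset.1 (hKs hv)] at this

theorem exists_maximum_isClique_subset (G : SimpleGraph V) (S : Finset V) :
    ∃ K ⊆ S, G.IsClique (K : Set V) ∧ ∀ L ⊆ S, G.IsClique (L : Set V) → #L ≤ #K := by
  classical
  obtain ⟨K, hK, hmax⟩ := exists_max_image {K ∈ S.powerset | G.IsClique (SetLike.coe K)} card
    ⟨∅, by simp⟩
  simp only [mem_filter, mem_powerset] at hK hmax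
  exact ⟨K, hK.1, hK.2, fun L hL hL' => hmax L ⟨hL, hL'⟩⟩

theorem card_inter_le_one_of_isClique_of_isClique_compl [DecidableEq V] {G : SimpleGraph V}
    {K A : Finset V} (hK : G.IsClique (K : Set V)) (hA : Gᶜ.IsClique (A : Set V)) :
    #(K ∩ A) ≤ 1 := by
  rw [card_le_one]
  intro v hv w hw
  rw [mem_inter] at hv hw
  by_contra hvw
  exact (hA hv.2 hw.2 hvw).2 (hK hv.1 hw.1 hvw)

/-- If `K i` is disjoint from `A i` and meets `A j` in exactly one point for `j ≠ i`, then
the incidence vectors of the `K i` are linearly independent. -/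
theorem card_le_card_of_card_inter_eq {ι : Type*} [Fintype ι] [DecidableEq ι] [DecidableEq V]
    (hι : 1 < Fintype.card ι) {S : Finset V} {K A : ι → Finset V} (hK : ∀ i, K i ⊆ S)
    (h : ∀ i j, #(K i ∩ A j) = if i = j then 0 else 1) : Fintype.card ι ≤ #S := by
  let N : (ι → ℚ) →ₗ[ℚ] (S → ℚ) :=
    Matrix.mulVecLin (Matrix.of fun (x : S) j => if x.1 ∈ A j then (1 : ℚ) else 0)
  have hN : Function.Injective N := by
    rw [← LinearMap.ker_eq_bot, LinearMap.ker_eq_bot']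
    intro g hg
    have hrow (i : ι) : g i = ∑ j, g j := by
      have h0 : ∑ x : S, (if x.1 ∈ K i then N g x else 0) = 0 := by simp [hg]
      have h1 : ∑ x : S, (if x.1 ∈ K i then N g x else 0) = ∑ j, (#(K i ∩ A j) : ℚ) * g j := by
        change ∑ x : S, (if x.1 ∈ K i then
          ∑ j, (if x.1 ∈ A j then (1 : ℚ) else 0) * g j else 0) = _
        rw [sum_coe_sort S fun x => if x ∈ K i then
            ∑ j, (if x ∈ A j then (1 : ℚ) else 0) * g j else 0, ← sum_filter,
          filter_mem_eq_inter, inter_eq_right.2 (hK i), sum_comm]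
        simp_rw [← sum_mul, sum_boole, filter_mem_eq_inter]
      rw [h1] at h0
      simp_rw [h] at h0
      have h2 : ∑ j, (((if i = j then 0 else 1 : ℕ) : ℚ) * g j) = ∑ j, g j - g i := by
        rw [eq_sub_iff_add_eq, ← Fintype.sum_ite_eq i g, ← sum_add_distrib]
        refine sum_congr rfl fun j _ => ?_
        split_ifs <;> simp
      linarith
    have ht : ∑ j, g j = Fintype.card ι * ∑ j, g j := by
      conv_lhs => rw [sum_congr rfl fun j _ => hrow j]
      simp
    have hι' : (1 : ℚ) < Fintype.card ι := by exact_mod_cast hι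
    have : ∑ j, g j = 0 := by
      have : ((Fintype.card ι : ℚ) - 1) * ∑ j, g j = 0 := by linarith
      exact (mul_eq_zero.1 this).resolve_left (by linarith)
    funext i
    simp [hrow i, this]
  simpa using LinearMap.finrank_le_finrank_of_injective hN

/-- Lovász's criterion for perfection; sufficiency follows Gasparian's rank argument. -/
theorem isPerfect_iff_forall_card_le_mul [Fintype V] {G : SimpleGraph V} :
    G.IsPerfect ↔ ∀ S : Finset V, ∃ K ⊆ S, ∃ I ⊆ S,
      G.IsClique (K : Set V) ∧ Gᶜ.IsClique (I : Set V) ∧ #S ≤ #K * #I := by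
  classical
  rw [isPerfect_iff_forall_colorableOn]
  constructor
  · intro h S
    obtain ⟨K, hKS, hK, f, hf, hf'⟩ := h S
    obtain ⟨I, hIS, hI, hmax⟩ := Gᶜ.exists_maximum_isClique_subset S
    refine ⟨K, hKS, I, hIS, hK, hI, ?_⟩
    have := card_le_mul_card_image_of_maps_to (t := range #K)
      (fun v hv => mem_range.2 (hf v hv)) #I fun c _ => hmax {v ∈ S | f v = c}
        (filter_subset _ _) fun v hv w hw hvw => by
          simp only [coe_filter, Set.mem_ofPred_eq] at hv hw
          exact ⟨hvw, fun hadj => hf' v hv.1 w hw.1 hadj (hv.2.trans hw.2.symm)⟩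
    rwa [card_range, mul_comm] at this
  · intro h S
    induction S using Finset.strongInduction with
    | H S ih =>
    obtain ⟨K, hKS, hK, hKmax⟩ := G.exists_maximum_isClique_subset S
    obtain ⟨I, hIS, hI, hImax⟩ := Gᶜ.exists_maximum_isClique_subset S
    refine ⟨K, hKS, hK, ?_⟩
    by_contra hcol
    have hle : #S ≤ #K * #I := by
      obtain ⟨K', hK'S, I', hI'S, hK', hI', hle⟩ := h S
      exact hle.trans (Nat.mul_le_mul (hKmax K' hK'S hK') (hImax I' hI'S hI'))
    have hS : S.Nonempty := by
      rw [nonempty_iff_ne_empty]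
      rintro rfl
      exact hcol ⟨fun _ => 0, by simp, by simp⟩
    have hclique (A : Finset V) (hAS : A ⊆ S) (hA : Gᶜ.IsClique (A : Set V)) :
        ∃ L ⊆ S, G.IsClique (L : Set V) ∧ #L = #K ∧ #(L ∩ A) = 0 := by
      rcases A.eq_empty_or_nonempty with rfl | hne
      · exact ⟨K, hKS, hK, rfl, by simp⟩
      obtain ⟨L, hLS, hL, f, hf, hf'⟩ := ih (S \ A) (sdiff_ssubset hAS hne)
      refine ⟨L, hLS.trans sdiff_subset, hL, ?_, ?_⟩
      · refine (hKmax L (hLS.trans sdiff_subset) hL).antisymm (not_lt.1 fun hlt => hcol ?_)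
        refine ColorableOn.mono (k := #L + 1) ⟨fun v => if v ∈ A then #L else f v, ?_, ?_⟩ hlt
        · intro v hv
          by_cases hvA : v ∈ A
          · simp [hvA]
          · have := hf v (mem_sdiff.2 ⟨hv, hvA⟩)
            simp only [hvA, if_false]
            omega
        · intro v hv w hw hadj
          by_cases hvA : v ∈ A <;> by_cases hwA : w ∈ A
          · exact absurd hadj (hA hvA hwA hadj.ne).2
          · simpa [hvA, hwA] using (hf w (mem_sdiff.2 ⟨hw, hwA⟩)).ne'
          · simpa [hvA, hwA] using (hf v (mem_sdiff.2 ⟨hv, hvA⟩)).ne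
          · simpa [hvA, hwA] using
              hf' v (mem_sdiff.2 ⟨hv, hvA⟩) w (mem_sdiff.2 ⟨hw, hwA⟩) hadj
      · rw [card_eq_zero, ← disjoint_iff_inter_eq_empty]
        exact disjoint_sdiff_self_left.mono_left hLS
    have herase (v : I) : G.ColorableOn (S.erase v) #K := by
      obtain ⟨L, hLS, hL, hc⟩ := ih (S.erase v) (erase_ssubset (hIS v.2))
      exact hc.mono (hKmax L (hLS.trans (erase_subset _ _)) hL)
    choose f hf hf' using herase
    let A : Option (I × Fin #K) → Finset V := fun i =>
      i.elim I fun p => {x ∈ S.erase p.1 | f p.1 x = p.2}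
    have hAS (i) : A i ⊆ S := by
      rcases i with - | p
      · exact hIS
      · exact (filter_subset _ _).trans (erase_subset _ _)
    have hA (i) : Gᶜ.IsClique (A i : Set V) := by
      rcases i with - | p
      · exact hI
      · intro v hv w hw hvw
        simp only [A, Option.elim, coe_filter, Set.mem_ofPred_eq] at hv hw
        exact ⟨hvw, fun hadj => hf' p.1 v hv.1 w hw.1 hadj (hv.2.trans hw.2.symm)⟩
    choose L hLS hL hLcard hLA using fun i => hclique (A i) (hAS i) (hA i)
    -- Every vertex of `S` lies in exactly `#I` of the sets `A i`.
    have hcover (x : V) (hx : x ∈ S) : ∑ i, (if x ∈ A i then 1 else 0) = #I := by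
      have hfib (v : I) :
          ∑ c : Fin #K, (if x ∈ A (some (v, c)) then 1 else 0) = if x = v then 0 else 1 := by
        by_cases hxv : x = v
        · simp [A, hxv]
        · have hlt := hf v x (mem_erase.2 ⟨hxv, hx⟩)
          have (c : Fin #K) : x ∈ A (some (v, c)) ↔ c = ⟨f v x, hlt⟩ := by
            simp [A, hxv, hx, Fin.ext_iff, eq_comm]
          simp [this, hxv]
      rw [Fintype.sum_option, Fintype.sum_prod_type]
      simp_rw [hfib]
      rw [sum_coe_sort I fun v => if x = v then 0 else 1]
      have hsum : ∑ v ∈ I, (if x = v then 1 else 0) + ∑ v ∈ I, (if x = v then 0 else 1) = #I := by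
        rw [← sum_add_distrib, card_eq_sum_ones]
        refine sum_congr rfl fun v _ => ?_
        split_ifs <;> rfl
      rwa [sum_ite_eq] at hsum
    have hcount (i) : ∑ j, #(L i ∩ A j) = #K * #I := by
      simp_rw [← filter_mem_eq_inter, card_filter]
      rw [sum_comm, sum_congr rfl fun x hx => hcover x (hLS i hx), sum_const, hLcard, smul_eq_mul]
    have hcardι : Fintype.card (Option (I × Fin #K)) = #K * #I + 1 := by
      simp [mul_comm]
    have hinter (i j) : #(L i ∩ A j) = if i = j then 0 else 1 := by
      have hle' (j) : #(L i ∩ A j) ≤ if i = j then 0 else 1 := by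
        split_ifs with hij
        · rw [← hij, hLA]
        · exact card_inter_le_one_of_isClique_of_isClique_compl (hL i) (hA j)
      refine (sum_eq_sum_iff_of_le fun j _ => hle' j).1 ?_ j (mem_univ j)
      have hsum : ∑ j, (if i = j then 1 else 0) + ∑ j, (if i = j then 0 else 1) =
          #K * #I + 1 := by
        rw [← hcardι, ← sum_add_distrib, Fintype.card_eq_sum_ones]
        refine sum_congr rfl fun j _ => ?_
        split_ifs <;> rfl
      rw [Fintype.sum_ite_eq] at hsum
      rw [hcount]
      omega
    have := card_le_card_of_card_inter_eq (by have := hS.card_pos; omega) hLS hinter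
    omega

end SimpleGraph

/-- Weak Perfect Graph Theorem: a finite simple graph is perfect iff its
complement is perfect. -/
theorem weak_perfect_graph_theorem {V : Type*} [Fintype V] (G : SimpleGraph V) :
    G.IsPerfect ↔ Gᶜ.IsPerfect := by
  simp only [isPerfect_iff_forall_card_le_mul, compl_compl]
  constructor <;>
  · intro h S
    obtain ⟨K, hKS, I, hIS, hK, hI, hle⟩ := h S
    exact ⟨I, hIS, K, hKS, hI, hK, by rwa [mul_comm]⟩
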